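/- arXiv:2602.23593 — 4 statements merged into one kernel-verified Lean document; each statement's English description precedes it below -/
import Mathlib

section
/- Let σ > 0 and ε ≥ 0. Let g : ℝ → ℝ be continuous with |g(t)| ≤ ε for all t ≥ 0, and let e : ℝ → ℝ be differentiable with e'(t) = -σ·e(t) + g(t) for all t ≥ 0. Then limsup_{t → ∞} |e(t)| ≤ ε/σ. -/
/-- Exponentially weighted bound for a scalar linear ODE with a bounded forcing term. -/
theorem abs_le_of_deriv_eq_neg_mul_add {σ ε : ℝ} (hσ : σ ≠ 0) {g e : ℝ → ℝ}
    (hgb : ∀ t : ℝ, 0 ≤ t → |g t| ≤ ε)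
    (he : ∀ t : ℝ, 0 ≤ t → HasDerivAt e (-σ * e t + g t) t) {t : ℝ} (ht : 0 ≤ t) :
    |e t| ≤ (|e 0| - ε / σ) * Real.exp (-(σ * t)) + ε / σ := by
  have hexp (x : ℝ) : HasDerivAt (fun y => Real.exp (σ * y)) (σ * Real.exp (σ * x)) x := by
    simpa [mul_comm] using ((hasDerivAt_id x).const_mul σ).exp
  have hf (x : ℝ) (hx : 0 ≤ x) :
      HasDerivAt (fun y => e y * Real.exp (σ * y)) (g x * Real.exp (σ * x)) x := by
    refine ((he x hx).mul (hexp x)).congr_deriv ?_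
    ring
  have hB (x : ℝ) : HasDerivAt (fun y => (|e 0| - ε / σ) + ε / σ * Real.exp (σ * y))
      (ε * Real.exp (σ * x)) x := by
    refine (((hexp x).const_mul (ε / σ)).const_add (|e 0| - ε / σ)).congr_deriv ?_
    field_simp
  have h := image_norm_le_of_norm_deriv_right_le_deriv_boundary (a := 0) (b := t)
    (fun x hx => (hf x hx.1).continuousAt.continuousWithinAt)
    (fun x hx => (hf x hx.1).hasDerivWithinAt) (by simp) hB
    (fun x hx => by
      rw [norm_mul, Real.norm_eq_abs, Real.norm_eq_abs, Real.abs_exp]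
      exact mul_le_mul_of_nonneg_right (hgb x hx.1) (Real.exp_pos _).le)
    (Set.right_mem_Icc.2 ht)
  rw [norm_mul, Real.norm_eq_abs, Real.norm_eq_abs, Real.abs_exp] at h
  rw [Real.exp_neg, ← mul_le_mul_iff_left₀ (Real.exp_pos (σ * t)), add_mul,
    inv_mul_cancel_right₀ (Real.exp_pos _).ne']
  exact h

theorem filter_error_limsup
    (σ ε : ℝ) (hσ : 0 < σ) (hε : 0 ≤ ε)
    (g e : ℝ → ℝ)
    (hg : Continuous g)
    (hgb : ∀ t : ℝ, 0 ≤ t → |g t| ≤ ε)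
    (he : Differentiable ℝ e)
    (hode : ∀ t : ℝ, 0 ≤ t → deriv e t = -σ * e t + g t) :
    Filter.limsup (fun t : ℝ => |e t|) Filter.atTop ≤ ε / σ := by
  have hlim : Filter.Tendsto (fun t => (|e 0| - ε / σ) * Real.exp (-(σ * t)) + ε / σ)
      Filter.atTop (nhds (ε / σ)) := by
    simpa using ((Real.tendsto_exp_neg_atTop_nhds_zero.comp
      (Filter.tendsto_id.const_mul_atTop hσ)).const_mul (|e 0| - ε / σ)).add_const (ε / σ)
  rw [← hlim.limsup_eq]
  refine Filter.limsup_le_limsup ?_ ?_ hlim.isBoundedUnder_le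
  · filter_upwards [Filter.eventually_ge_atTop 0] with t ht
    exact abs_le_of_deriv_eq_neg_mul_add hσ.ne' hgb
      (fun s hs => hode s hs ▸ (he s).hasDerivAt) ht
  · exact Filter.isCoboundedUnder_le_of_le Filter.atTop (x := 0) fun t => abs_nonneg _
end

section
/- Let c > 0, α ∈ (0,1), t₀ ∈ ℝ, and let x : ℝ → ℝ be differentiable with x'(t) = -c·sgn(x(t))·|x(t)|^α for all t ≥ t₀. Then x(t) = 0 for all t ≥ t₀ + |x(t₀)|^{1-α} / (c·(1-α)). -/
/-- Away from the origin, `|x| ^ (1 - α)` decreases at the constant rate `c * (1 - α)`. -/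
theorem hasDerivAt_abs_rpow_of_terminal_attractor {c α t : ℝ} {x : ℝ → ℝ}
    (hx : HasDerivAt x (-c * Real.sign (x t) * |x t| ^ α) t) (h0 : x t ≠ 0) :
    HasDerivAt (fun s => |x s| ^ (1 - α)) (-(c * (1 - α))) t := by
  have habs : HasDerivAt (fun s => |x s|) (-c * |x t| ^ α) t := by
    rcases h0.lt_or_gt with h | h
    · refine ((hasDerivAt_abs_neg h).comp t hx).congr_deriv ?_
      rw [Real.sign_of_neg h]
      ring
    · refine ((hasDerivAt_abs_pos h).comp t hx).congr_deriv ?_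
      rw [Real.sign_of_pos h]
      ring
  have hpos : 0 < |x t| := abs_pos.mpr h0
  refine (habs.rpow_const (p := 1 - α) (Or.inl hpos.ne')).congr_deriv ?_
  have hmul : |x t| ^ α * |x t| ^ (1 - α - 1) = 1 := by
    rw [← Real.rpow_add hpos]
    simp
  linear_combination (-c * (1 - α)) * hmul

/-- Trajectories of the terminal attractor have nonincreasing square. -/
theorem antitoneOn_sq_of_terminal_attractor {c α t₀ : ℝ} (hc : 0 ≤ c) {x : ℝ → ℝ}
    (hx : Differentiable ℝ x)
    (hode : ∀ t, t₀ ≤ t → deriv x t = -c * Real.sign (x t) * |x t| ^ α) :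
    AntitoneOn (fun t => x t ^ 2) (Set.Ici t₀) := by
  refine antitoneOn_of_deriv_nonpos (convex_Ici t₀) (hx.pow 2).continuous.continuousOn
    (hx.pow 2).differentiableOn fun t ht => ?_
  rw [interior_Ici] at ht
  have hd := (hx t).hasDerivAt.pow 2
  rw [hode t ht.le] at hd
  rw [show (fun t => x t ^ 2) = x ^ 2 from rfl, hd.deriv]
  have hsign : 0 ≤ Real.sign (x t) * x t := Real.sign_mul_nonneg (x t)
  have hprod := mul_nonneg (mul_nonneg hc hsign) (Real.rpow_nonneg (abs_nonneg (x t)) α)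
  norm_num
  linarith

theorem terminal_attractor_finite_time
    (c α t₀ : ℝ) (hc : 0 < c) (hα0 : 0 < α) (hα1 : α < 1)
    (x : ℝ → ℝ) (hx : Differentiable ℝ x)
    (hode : ∀ t : ℝ, t₀ ≤ t →
      deriv x t = -c * Real.sign (x t) * |x t| ^ α) :
    ∀ t : ℝ, t₀ + |x t₀| ^ (1 - α) / (c * (1 - α)) ≤ t → x t = 0 := by
  intro t ht
  by_contra h0
  have hrate : 0 < c * (1 - α) := mul_pos hc (sub_pos.mpr hα1)
  have htime : 0 ≤ |x t₀| ^ (1 - α) / (c * (1 - α)) := by positivity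
  have ht₀ : t₀ ≤ t := by linarith
  have hne : ∀ s ∈ Set.Icc t₀ t, x s ≠ 0 := by
    intro s hs hzero
    have hle : x t ^ 2 ≤ x s ^ 2 :=
      antitoneOn_sq_of_terminal_attractor hc.le hx hode hs.1 ht₀ hs.2
    have hpos : 0 < x t ^ 2 := by positivity
    rw [hzero] at hle
    linarith
  have hderiv : ∀ s ∈ Set.Icc t₀ t,
      HasDerivAt (fun s => |x s| ^ (1 - α) + c * (1 - α) * s) 0 s := by
    intro s hs
    have hd := hasDerivAt_abs_rpow_of_terminal_attractor
      (hode s hs.1 ▸ (hx s).hasDerivAt) (hne s hs)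
    exact (hd.add ((hasDerivAt_id s).const_mul (c * (1 - α)))).congr_deriv (by ring)
  have hconst : |x t| ^ (1 - α) + c * (1 - α) * t = |x t₀| ^ (1 - α) + c * (1 - α) * t₀ :=
    constant_of_has_deriv_right_zero
      (fun s hs => (hderiv s hs).continuousAt.continuousWithinAt)
      (fun s hs => (hderiv s (Set.Ico_subset_Icc_self hs)).hasDerivWithinAt)
      t (Set.right_mem_Icc.mpr ht₀)
  have hbound : |x t₀| ^ (1 - α) ≤ (t - t₀) * (c * (1 - α)) :=
    (div_le_iff₀ hrate).mp (by linarith)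
  have hpos : 0 < |x t| ^ (1 - α) := Real.rpow_pos_of_pos (abs_pos.mpr h0) _
  linarith
end

section
/- Let p > q be positive odd integers with 1 < p/q < 2, let k₁ > 0 and t₀ ∈ ℝ, and let z̃₁ : ℝ → ℝ be differentiable with z̃₁'(t) = -k₁^{-q/p}·sgn(z̃₁(t))·|z̃₁(t)|^{q/p} for all t ≥ t₀. Then z̃₁(t) = 0 for all t ≥ t₀ + T, where T = k₁^{q/p}·(p/(p-q))·|z̃₁(t₀)|^{1 - q/p}. -/
lemma Real.mul_sign_self (x : ℝ) : x * Real.sign x = |x| := by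
  rcases lt_trichotomy x 0 with h | rfl | h
  · simp [Real.sign_of_neg h, abs_of_neg h]
  · simp
  · simp [Real.sign_of_pos h, abs_of_pos h]

/-- Along a solution of `z' = -c sgn(z) |z|^r` with `c ≥ 0`, the square of `z` decreases. -/
lemma antitoneOn_sq_of_deriv_eq_sign_mul_rpow {c r t₀ : ℝ} (hc : 0 ≤ c) {z : ℝ → ℝ}
    (hz : Differentiable ℝ z)
    (hode : ∀ t, t₀ ≤ t → deriv z t = -c * Real.sign (z t) * |z t| ^ r) :
    AntitoneOn (fun t => z t ^ 2) (Set.Ici t₀) := by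
  refine antitoneOn_of_deriv_nonpos (convex_Ici t₀) (hz.pow 2).continuous.continuousOn
    (hz.pow 2).differentiableOn fun t ht => ?_
  rw [interior_Ici] at ht
  have hd : deriv (fun t => z t ^ 2) t = -(2 * c * |z t| * |z t| ^ r) := by
    rw [((hz t).hasDerivAt.fun_pow 2).deriv, hode t ht.le, ← Real.mul_sign_self]
    push_cast
    ring
  rw [hd]
  exact neg_nonpos.2 (by positivity)

/-- Away from the zeros of a solution of `z' = -c sgn(z) |z|^r`, the function `|z|^(1-r)`, written
as `(z²)^((1-r)/2)`, decreases at the constant rate `c (1 - r)`. -/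
lemma hasDerivAt_sq_rpow_of_hasDerivAt_sign_mul_rpow {c r t : ℝ} {z : ℝ → ℝ} (h0 : z t ≠ 0)
    (hz : HasDerivAt z (-c * Real.sign (z t) * |z t| ^ r) t) :
    HasDerivAt (fun s => (z s ^ 2) ^ ((1 - r) / 2)) (-(c * (1 - r))) t := by
  have ha : 0 < |z t| := abs_pos.2 h0
  convert (hz.fun_pow 2).rpow_const (p := (1 - r) / 2) (Or.inl (pow_ne_zero 2 h0)) using 1
  have h1 : (z t ^ 2) ^ ((1 - r) / 2 - 1) = |z t| ^ (-1 - r) := by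
    rw [← sq_abs, ← Real.rpow_natCast, ← Real.rpow_mul ha.le]
    congr 1
    push_cast
    ring
  have h2 : |z t| * |z t| ^ r * |z t| ^ (-1 - r) = 1 := by
    nth_rewrite 1 [← Real.rpow_one |z t|]
    rw [← Real.rpow_add ha, ← Real.rpow_add ha]
    simp
  rw [h1]
  calc -(c * (1 - r)) = -(c * (1 - r)) * (|z t| * |z t| ^ r * |z t| ^ (-1 - r)) := by
        rw [h2, mul_one]
    _ = -(c * (1 - r)) * (z t * Real.sign (z t) * |z t| ^ r * |z t| ^ (-1 - r)) := by
        rw [Real.mul_sign_self]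
    _ = _ := by
        push_cast
        ring

/-- Solutions of `z' = -c sgn(z) |z|^r` with `c > 0` vanish once `c (1 - r)` times the
elapsed time exceeds the initial value of `|z|^(1-r)`. -/
lemma eq_zero_of_deriv_eq_sign_mul_rpow {c r t₀ : ℝ} (hc : 0 < c) {z : ℝ → ℝ}
    (hz : Differentiable ℝ z)
    (hode : ∀ t, t₀ ≤ t → deriv z t = -c * Real.sign (z t) * |z t| ^ r)
    {t : ℝ} (ht₀ : t₀ ≤ t) (ht : |z t₀| ^ (1 - r) ≤ c * (1 - r) * (t - t₀)) : z t = 0 := by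
  by_contra h0
  have hne : ∀ s ∈ Set.Icc t₀ t, z s ≠ 0 := fun s hs h => by
    have h1 := antitoneOn_sq_of_deriv_eq_sign_mul_rpow hc.le hz hode hs.1 ht₀ hs.2
    have h2 : 0 < z t ^ 2 := by positivity
    simp only [h] at h1
    linarith
  have hd : ∀ s ∈ Set.Icc t₀ t, HasDerivAt
      (fun s => (z s ^ 2) ^ ((1 - r) / 2) + c * (1 - r) * s) 0 s := fun s hs => by
    have h1 := hasDerivAt_sq_rpow_of_hasDerivAt_sign_mul_rpow (hne s hs)
      (hode s hs.1 ▸ (hz s).hasDerivAt)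
    simpa using h1.fun_add ((hasDerivAt_id s).const_mul (c * (1 - r)))
  have hanti := antitoneOn_of_deriv_nonpos (convex_Icc t₀ t)
    (fun s hs => (hd s hs).continuousAt.continuousWithinAt)
    (fun s hs => (hd s (interior_subset hs)).differentiableAt.differentiableWithinAt)
    (fun s hs => (hd s (interior_subset hs)).deriv.le)
  have hle := hanti (Set.left_mem_Icc.2 ht₀) (Set.right_mem_Icc.2 ht₀) ht₀
  have hpos : 0 < (z t ^ 2) ^ ((1 - r) / 2) := by positivity
  have hinit : (z t₀ ^ 2) ^ ((1 - r) / 2) = |z t₀| ^ (1 - r) := by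
    rw [← sq_abs, ← Real.rpow_natCast, ← Real.rpow_mul (abs_nonneg _)]
    congr 1
    push_cast
    ring
  simp only [hinit] at hle
  linarith

theorem sliding_manifold_voltage_finite_time
    (p q : ℕ) (hp : Odd p) (hq : Odd q) (hq0 : 0 < q) (hqp : q < p)
    (hratio1 : 1 < (p : ℝ) / q) (hratio2 : (p : ℝ) / q < 2)
    (k₁ t₀ : ℝ) (hk₁ : 0 < k₁)
    (z : ℝ → ℝ) (hz : Differentiable ℝ z)
    (hode : ∀ t : ℝ, t₀ ≤ t →
      deriv z t = -k₁ ^ (-(q : ℝ) / p) * Real.sign (z t) * |z t| ^ ((q : ℝ) / p)) :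
    ∀ t : ℝ,
      t₀ + k₁ ^ ((q : ℝ) / p) * ((p : ℝ) / ((p : ℝ) - q)) * |z t₀| ^ (1 - (q : ℝ) / p) ≤ t →
      z t = 0 := by
  intro t ht
  have hp0 : (0 : ℝ) < p := by exact_mod_cast hq0.trans hqp
  have hpq : (0 : ℝ) < p - q := sub_pos.2 (by exact_mod_cast hqp)
  have hk : 0 < k₁ ^ ((q : ℝ) / p) := Real.rpow_pos_of_pos hk₁ _
  have hT : 0 ≤ k₁ ^ ((q : ℝ) / p) * ((p : ℝ) / ((p : ℝ) - q)) *
      |z t₀| ^ (1 - (q : ℝ) / p) := by positivity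
  refine eq_zero_of_deriv_eq_sign_mul_rpow (Real.rpow_pos_of_pos hk₁ _)
    hz hode (by linarith) ?_
  rw [neg_div, Real.rpow_neg hk₁.le]
  have hr : 1 - (q : ℝ) / p = (p - q) / p := by field_simp
  calc |z t₀| ^ (1 - (q : ℝ) / p)
      = (k₁ ^ ((q : ℝ) / p))⁻¹ * (1 - (q : ℝ) / p) * (k₁ ^ ((q : ℝ) / p) *
          ((p : ℝ) / ((p : ℝ) - q)) * |z t₀| ^ (1 - (q : ℝ) / p)) := by
        rw [hr]
        field_simp
    _ ≤ _ := by
        have : 0 ≤ 1 - (q : ℝ) / p := by rw [hr]; positivity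
        gcongr
        linarith
end

section
/- Let n ≥ 1, δ ≥ 0, η > 0, ε > 0, and let s, ρ ∈ ℝⁿ with ‖ρ‖₂ ≤ δ and |s_i| ≥ ε for every i. Then ⟨s, -(δ+η)·sat(s/ε) + ρ⟩ ≤ -η·‖s‖₂, where ⟨·,·⟩ is the Euclidean inner product and ‖s‖₂ = √(∑ s_i²). -/
/-- The scalar saturation function: identity inside `[-1,1]`, sign outside. -/
noncomputable def satc (x : ℝ) : ℝ := if |x| ≤ 1 then x else Real.sign x

/-- Multiplying a saturated component by its saturation gives its absolute value. -/
theorem mul_satc_div {x ε : ℝ} (hε : 0 < ε) (hx : ε ≤ |x|) : x * satc (x / ε) = |x| := by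
  have hsign (y : ℝ) : y * Real.sign y = |y| := by
    rcases lt_trichotomy y 0 with h | h | h
    · simp [Real.sign_of_neg h, abs_of_neg h]
    · simp [h]
    · simp [Real.sign_of_pos h, abs_of_pos h]
  unfold satc
  split_ifs with h
  · rw [abs_div, abs_of_pos hε, div_le_one hε] at h
    have hxε : |x| = ε := le_antisymm h hx
    rw [← hxε, ← mul_div_assoc, ← abs_mul_abs_self x, mul_div_assoc,
      div_self (hxε ▸ hε.ne'), mul_one]
  · have hdiv := hsign (x / ε)
    rw [abs_div, abs_of_pos hε, div_mul_eq_mul_div, div_left_inj' hε.ne'] at hdiv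
    exact hdiv

/-- The Euclidean norm is bounded by the sum of the absolute values of the components. -/
theorem sqrt_sum_sq_le_sum_abs {ι : Type*} (t : Finset ι) (x : ι → ℝ) :
    Real.sqrt (∑ i ∈ t, x i ^ 2) ≤ ∑ i ∈ t, |x i| := by
  refine Real.sqrt_le_iff.mpr ⟨Finset.sum_nonneg fun i _ => abs_nonneg _, ?_⟩
  simpa only [sq_abs] using Finset.sum_sq_le_sq_sum_of_nonneg (s := t) (f := fun i => |x i|) fun i _ => abs_nonneg _

theorem reaching_law_estimate
    (n : ℕ) (hn : 1 ≤ n) (δ η ε : ℝ) (hδ : 0 ≤ δ) (hη : 0 < η) (hε : 0 < ε)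
    (s ρ : Fin n → ℝ)
    (hρ : Real.sqrt (∑ i, (ρ i) ^ 2) ≤ δ)
    (hs : ∀ i, ε ≤ |s i|) :
    ∑ i, s i * (-(δ + η) * satc (s i / ε) + ρ i) ≤
      -η * Real.sqrt (∑ i, (s i) ^ 2) := by
  have hsum : ∑ i, s i * (-(δ + η) * satc (s i / ε) + ρ i) =
      -(δ + η) * ∑ i, |s i| + ∑ i, s i * ρ i := by
    rw [Finset.mul_sum, ← Finset.sum_add_distrib]
    refine Finset.sum_congr rfl fun i _ => ?_
    rw [← mul_satc_div hε (hs i)]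
    ring
  have hcs : ∑ i, s i * ρ i ≤ Real.sqrt (∑ i, s i ^ 2) * δ :=
    (Real.sum_mul_le_sqrt_mul_sqrt _ _ _).trans
      (mul_le_mul_of_nonneg_left hρ (Real.sqrt_nonneg _))
  have hnorm := mul_le_mul_of_nonneg_left (sqrt_sum_sq_le_sum_abs Finset.univ s)
    (add_nonneg hδ hη.le)
  rw [hsum]
  linarith
end
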